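/- Let l : ℕ → ℝ be a sequence that is bounded from below, and let c : ℕ → ℝ be a sequence of nonnegative reals with Σ_{k=0}^{∞} c_k < ∞. Suppose l_{k+1} − l_k ≤ c_k for every k. Then Σ_{k=0}^{∞} |l_{k+1} − l_k| < ∞. -/

import Mathlib

/-- If the per-step increases of a lower-bounded real sequence are dominated by
a summable nonnegative sequence, then the total variation of the sequence is
finite. -/
theorem summable_abs_increments_of_bddBelow
    (l : ℕ → ℝ) (hbdd : BddBelow (Set.range l))
    (c : ℕ → ℝ) (hc : ∀ k, 0 ≤ c k) (hcs : Summable c)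
    (hstep : ∀ k, l (k + 1) - l k ≤ c k) :
    Summable (fun k => |l (k + 1) - l k|) := by
  obtain ⟨m, hm⟩ := hbdd
  refine summable_of_sum_range_le (c := 2 * ∑' k, c k - (m - l 0)) (fun _ => abs_nonneg _)
    fun n => ?_
  calc ∑ k ∈ Finset.range n, |l (k + 1) - l k|
      ≤ ∑ k ∈ Finset.range n, (2 * c k - (l (k + 1) - l k)) :=
        Finset.sum_le_sum fun k _ =>
          abs_le.2 ⟨by linarith [hc k], by linarith [hstep k]⟩
    _ = 2 * ∑ k ∈ Finset.range n, c k - (l n - l 0) := by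
        rw [Finset.sum_sub_distrib, ← Finset.mul_sum, Finset.sum_range_sub]
    _ ≤ 2 * ∑' k, c k - (m - l 0) := by
        linarith [hcs.sum_le_tsum (Finset.range n) fun k _ => hc k, hm (Set.mem_range_self n)]
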